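/- Pick gamma in F. There exists an algebra isomorphism from the Z3-symmetric down-up algebra A(2,-1,gamma) to the universal enveloping algebra U(L(gamma)) of the Z3-symmetric down-up Lie algebra L(gamma), sending A to A, B to B, and C to C. -/

import Mathlib

noncomputable section

/-- The generators of the free algebra on three generators. -/
abbrev XX (F : Type*) [Field F] (i : Fin 3) : FreeAlgebra F (Fin 3) := FreeAlgebra.ι F i

/-- The defining relations of the Z3-symmetric down-up algebra. -/
inductive DURel (F : Type*) [Field F] (α β γ : F) :
    FreeAlgebra F (Fin 3) → FreeAlgebra F (Fin 3) → Prop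
  | r1 : DURel F α β γ (XX F 1 * XX F 0 ^ 2)
      (α • (XX F 0 * XX F 1 * XX F 0) + β • (XX F 0 ^ 2 * XX F 1) + γ • XX F 0)
  | r2 : DURel F α β γ (XX F 1 ^ 2 * XX F 0)
      (α • (XX F 1 * XX F 0 * XX F 1) + β • (XX F 0 * XX F 1 ^ 2) + γ • XX F 1)
  | r3 : DURel F α β γ (XX F 2 * XX F 1 ^ 2)
      (α • (XX F 1 * XX F 2 * XX F 1) + β • (XX F 1 ^ 2 * XX F 2) + γ • XX F 1)
  | r4 : DURel F α β γ (XX F 2 ^ 2 * XX F 1)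
      (α • (XX F 2 * XX F 1 * XX F 2) + β • (XX F 1 * XX F 2 ^ 2) + γ • XX F 2)
  | r5 : DURel F α β γ (XX F 0 * XX F 2 ^ 2)
      (α • (XX F 2 * XX F 0 * XX F 2) + β • (XX F 2 ^ 2 * XX F 0) + γ • XX F 2)
  | r6 : DURel F α β γ (XX F 0 ^ 2 * XX F 2)
      (α • (XX F 0 * XX F 2 * XX F 0) + β • (XX F 2 * XX F 0 ^ 2) + γ • XX F 0)

/-- The Z3-symmetric down-up algebra `𝔸(α,β,γ)`: with generators `A = 0`, `B = 1`, `C = 2`. -/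
abbrev DU (F : Type*) [Field F] (α β γ : F) := RingQuot (DURel F α β γ)

/-- The standard generators `A, B, C` of the Z3-symmetric down-up algebra. -/
def DUgen (F : Type*) [Field F] (α β γ : F) (i : Fin 3) : DU F α β γ :=
  RingQuot.mkAlgHom F (DURel F α β γ) (XX F i)


/-- The six defining relators of the Z3-symmetric down-up Lie algebra `𝕃(γ)`,
with generators `A = 0`, `B = 1`, `C = 2`. -/
def LieRels (F : Type*) [Field F] (γ : F) : Set (FreeLieAlgebra F (Fin 3)) :=
  let a := FreeLieAlgebra.of F (0 : Fin 3)
  let b := FreeLieAlgebra.of F (1 : Fin 3)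
  let c := FreeLieAlgebra.of F (2 : Fin 3)
  {⁅a, ⁅a, b⁆⁆ - γ • a, ⁅b, ⁅b, a⁆⁆ - γ • b,
   ⁅b, ⁅b, c⁆⁆ - γ • b, ⁅c, ⁅c, b⁆⁆ - γ • c,
   ⁅c, ⁅c, a⁆⁆ - γ • c, ⁅a, ⁅a, c⁆⁆ - γ • a}

/-- The Lie ideal of the free Lie algebra generated by the relators. -/
abbrev LieDUIdeal (F : Type*) [Field F] (γ : F) : LieIdeal F (FreeLieAlgebra F (Fin 3)) :=
  LieSubmodule.lieSpan F (FreeLieAlgebra F (Fin 3)) (LieRels F γ)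

/-- The Z3-symmetric down-up Lie algebra `𝕃(γ)`. -/
abbrev LieDU (F : Type*) [Field F] (γ : F) :=
  FreeLieAlgebra F (Fin 3) ⧸ LieDUIdeal F γ

/-- The standard generators `A, B, C` of `𝕃(γ)`. -/
def LieDUgen (F : Type*) [Field F] (γ : F) (i : Fin 3) : LieDU F γ :=
  LieSubmodule.Quotient.mk' (LieDUIdeal F γ) (FreeLieAlgebra.of F i)

section

attribute [local instance] LieRing.ofAssociativeRing

/-- A Lie algebra morphism whose kernel contains a Lie ideal descends to the quotient. -/
def LieIdeal.quotientLift {R L L' : Type*} [CommRing R] [LieRing L] [LieAlgebra R L]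
    [LieRing L'] [LieAlgebra R L'] (I : LieIdeal R L) (f : L →ₗ⁅R⁆ L') (h : I ≤ f.ker) :
    (L ⧸ I) →ₗ⁅R⁆ L' where
  toLinearMap := I.toSubmodule.liftQ (f : L →ₗ[R] L') fun _ hx => f.mem_ker.1 (h hx)
  map_lie' {x y} := by
    obtain ⟨x, rfl⟩ := LieSubmodule.Quotient.surjective_mk' I x
    obtain ⟨y, rfl⟩ := LieSubmodule.Quotient.surjective_mk' I y
    exact f.map_lie x y

/-- The double commutator expanded in an associative ring. -/
theorem lie_lie_self_eq {R : Type*} [Ring R] (x y : R) :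
    ⁅x, ⁅x, y⁆⁆ = x ^ 2 * y - (x * y * x + x * y * x) + y * x ^ 2 := by
  simp only [LieRing.of_associative_ring_bracket]
  noncomm_ring

section

variable {F R : Type*} [Field F] [Ring R] [Algebra F R] {γ : F} {x y : R}

theorem lie_lie_eq_smul_iff_mul_sq :
    ⁅x, ⁅x, y⁆⁆ = γ • x ↔
      y * x ^ 2 = (2 : F) • (x * y * x) + (-1 : F) • (x ^ 2 * y) + γ • x := by
  rw [lie_lie_self_eq, two_smul, neg_one_smul, ← sub_eq_zero, ← sub_eq_zero (a := y * x ^ 2)]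
  refine Eq.congr_left ?_
  abel

theorem lie_lie_eq_smul_iff_sq_mul :
    ⁅x, ⁅x, y⁆⁆ = γ • x ↔
      x ^ 2 * y = (2 : F) • (x * y * x) + (-1 : F) • (y * x ^ 2) + γ • x := by
  rw [lie_lie_self_eq, two_smul, neg_one_smul, ← sub_eq_zero, ← sub_eq_zero (a := x ^ 2 * y)]
  refine Eq.congr_left ?_
  abel

end

variable (F : Type*) [Field F] (γ : F)

/-- The generators of `𝔸(2,-1,γ)` induce a Lie algebra morphism from `𝕃(γ)`. -/
def LieDU.toDU : LieDU F γ →ₗ⁅F⁆ DU F 2 (-1) γ :=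
  LieIdeal.quotientLift (LieDUIdeal F γ) (FreeLieAlgebra.lift F (DUgen F 2 (-1) γ)) <| by
    rw [LieSubmodule.lieSpan_le]
    have rel {p q} (h : DURel F 2 (-1) γ p q) := RingQuot.mkAlgHom_rel F h
    have h1 := rel .r1
    have h2 := rel .r2
    have h3 := rel .r3
    have h4 := rel .r4
    have h5 := rel .r5
    have h6 := rel .r6
    simp only [map_add, map_mul, map_pow, map_smul] at h1 h2 h3 h4 h5 h6
    rintro _ (rfl | rfl | rfl | rfl | rfl | rfl) <;>
      simp only [SetLike.mem_coe, LieHom.mem_ker, map_sub, map_smul, LieHom.map_lie,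
        FreeLieAlgebra.lift_of_apply, sub_eq_zero]
    · exact lie_lie_eq_smul_iff_mul_sq.2 h1
    · exact lie_lie_eq_smul_iff_sq_mul.2 h2
    · exact lie_lie_eq_smul_iff_mul_sq.2 h3
    · exact lie_lie_eq_smul_iff_sq_mul.2 h4
    · exact lie_lie_eq_smul_iff_mul_sq.2 h5
    · exact lie_lie_eq_smul_iff_sq_mul.2 h6

theorem LieDU.toDU_gen (i : Fin 3) : LieDU.toDU F γ (LieDUgen F γ i) = DUgen F 2 (-1) γ i :=
  FreeLieAlgebra.lift_of_apply (DUgen F 2 (-1) γ) i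

/-- The defining relators of `𝕃(γ)` vanish in its universal enveloping algebra. -/
theorem LieDU.ι_lie_lie_gen {i j : Fin 3}
    (h : ⁅FreeLieAlgebra.of F i, ⁅FreeLieAlgebra.of F i, FreeLieAlgebra.of F j⁆⁆
      - γ • FreeLieAlgebra.of F i ∈ LieRels F γ) :
    ⁅UniversalEnvelopingAlgebra.ι F (LieDUgen F γ i),
      ⁅UniversalEnvelopingAlgebra.ι F (LieDUgen F γ i),
        UniversalEnvelopingAlgebra.ι F (LieDUgen F γ j)⁆⁆ =
      γ • UniversalEnvelopingAlgebra.ι F (LieDUgen F γ i) := by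
  have key : ⁅LieDUgen F γ i, ⁅LieDUgen F γ i, LieDUgen F γ j⁆⁆ = γ • LieDUgen F γ i :=
    sub_eq_zero.1 <| (LieSubmodule.Quotient.mk_eq_zero (N := LieDUIdeal F γ)).2
      (LieSubmodule.subset_lieSpan h)
  rw [← LieHom.map_lie, ← LieHom.map_lie, key, map_smul]

/-- The generators of `𝕃(γ)` induce an algebra morphism from `𝔸(2,-1,γ)`. -/
def DU.toEnveloping : DU F 2 (-1) γ →ₐ[F] UniversalEnvelopingAlgebra F (LieDU F γ) :=
  RingQuot.liftAlgHom F ⟨FreeAlgebra.lift F fun i =>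
      UniversalEnvelopingAlgebra.ι F (LieDUgen F γ i), by
    intro p q h
    cases h <;> simp only [map_add, map_mul, map_pow, map_smul, FreeAlgebra.lift_ι_apply] <;>
      first
      | exact lie_lie_eq_smul_iff_mul_sq.1 (LieDU.ι_lie_lie_gen F γ (by simp [LieRels]))
      | exact lie_lie_eq_smul_iff_sq_mul.1 (LieDU.ι_lie_lie_gen F γ (by simp [LieRels]))⟩

theorem DU.toEnveloping_gen (i : Fin 3) :
    DU.toEnveloping F γ (DUgen F 2 (-1) γ i) =
      UniversalEnvelopingAlgebra.ι F (LieDUgen F γ i) := by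
  simp only [DU.toEnveloping, DUgen, RingQuot.liftAlgHom_mkAlgHom_apply, FreeAlgebra.lift_ι_apply]

theorem LieDU.hom_ext {L : Type*} [LieRing L] [LieAlgebra F L] {f g : LieDU F γ →ₗ⁅F⁆ L}
    (h : ∀ i, f (LieDUgen F γ i) = g (LieDUgen F γ i)) : f = g := by
  let π : FreeLieAlgebra F (Fin 3) →ₗ⁅F⁆ LieDU F γ :=
    { LieSubmodule.Quotient.mk' (LieDUIdeal F γ) with map_lie' := rfl }
  have hπ : f.comp π = g.comp π := FreeLieAlgebra.hom_ext h
  ext x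
  obtain ⟨x, rfl⟩ := LieSubmodule.Quotient.surjective_mk' _ x
  exact LieHom.congr_fun hπ x

/-- The algebra isomorphism between `𝔸(2,-1,γ)` and the universal enveloping algebra of `𝕃(γ)`. -/
def DU.equivEnveloping : DU F 2 (-1) γ ≃ₐ[F] UniversalEnvelopingAlgebra F (LieDU F γ) :=
  AlgEquiv.ofAlgHom (DU.toEnveloping F γ) (UniversalEnvelopingAlgebra.lift F (LieDU.toDU F γ))
    (by
      apply UniversalEnvelopingAlgebra.hom_ext
      apply LieDU.hom_ext
      intro i
      change DU.toEnveloping F γ (UniversalEnvelopingAlgebra.lift F (LieDU.toDU F γ)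
        (UniversalEnvelopingAlgebra.ι F (LieDUgen F γ i))) = _
      rw [UniversalEnvelopingAlgebra.lift_ι_apply, LieDU.toDU_gen, DU.toEnveloping_gen]
      rfl)
    (by
      apply RingQuot.ringQuot_ext'
      apply FreeAlgebra.hom_ext
      ext i
      change UniversalEnvelopingAlgebra.lift F (LieDU.toDU F γ)
        (DU.toEnveloping F γ (DUgen F 2 (-1) γ i)) = DUgen F 2 (-1) γ i
      rw [DU.toEnveloping_gen, UniversalEnvelopingAlgebra.lift_ι_apply, LieDU.toDU_gen])

end

/-- an algebra isomorphism `𝔸(2,-1,γ) ≅ U(𝕃(γ))` sending `A ↦ A`, `B ↦ B`,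
`C ↦ C`. -/
theorem stmt7 (F : Type*) [Field F] [IsAlgClosed F] [CharZero F] (γ : F) :
    ∃ e : DU F 2 (-1) γ ≃ₐ[F] UniversalEnvelopingAlgebra F (LieDU F γ),
      e (DUgen F 2 (-1) γ 0) = UniversalEnvelopingAlgebra.ι F (LieDUgen F γ 0) ∧
      e (DUgen F 2 (-1) γ 1) = UniversalEnvelopingAlgebra.ι F (LieDUgen F γ 1) ∧
      e (DUgen F 2 (-1) γ 2) = UniversalEnvelopingAlgebra.ι F (LieDUgen F γ 2) :=
  ⟨DU.equivEnveloping F γ, DU.toEnveloping_gen F γ 0, DU.toEnveloping_gen F γ 1,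
    DU.toEnveloping_gen F γ 2⟩
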